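/- Let w ∈ S_n be almost defined by inclusions. Then there exists a unique permutation v ∈ S_n such that E(v) = E(w) ∖ E″(w) and r_v(p,q) = r_w(p,q) for all (p,q) ∈ E(v); moreover this v is defined by inclusions, and ℓ(v) − ℓ(w) equals the number of boxes of E″(w). -/

import Mathlib

/-- One-line notation value of a permutation of `Fin n` at a position `k ∈ {1,…,n}`;
junk value `0` outside that range. -/
def pval {n : ℕ} (w : Equiv.Perm (Fin n)) (k : ℕ) : ℕ :=
  if h : 1 ≤ k ∧ k ≤ n then ((w ⟨k - 1, by omega⟩ : Fin n) : ℕ) + 1 else 0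

/-- The rank function `r_w(p,q) = #{k ≤ q : w(k) ≥ p}`. -/
def rk {n : ℕ} (w : Equiv.Perm (Fin n)) (p q : ℕ) : ℕ :=
  ((Finset.Icc 1 n).filter fun k => k ≤ q ∧ p ≤ pval w k).card

/-- The Rothe diagram `D(w) = {(p,q) ∈ {1,…,n}² : w(q) < p and w⁻¹(p) > q}`. -/
def Diagram {n : ℕ} (w : Equiv.Perm (Fin n)) : Set (ℕ × ℕ) :=
  {pq | 1 ≤ pq.1 ∧ pq.1 ≤ n ∧ 1 ≤ pq.2 ∧ pq.2 ≤ n ∧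
    pval w pq.2 < pq.1 ∧ pq.2 < pval w.symm pq.1}

/-- The essential set `E(w)`. -/
def EssSet {n : ℕ} (w : Equiv.Perm (Fin n)) : Set (ℕ × ℕ) :=
  {pq | pq ∈ Diagram w ∧ (pq.1, pq.2 + 1) ∉ Diagram w ∧ (pq.1 - 1, pq.2) ∉ Diagram w}

/-- Condition A at `(p,q)`: there is no `k` with `k ≤ q` and `w(k) ≥ p`. -/
def CondA {n : ℕ} (w : Equiv.Perm (Fin n)) (p q : ℕ) : Prop :=
  ¬ ∃ k, 1 ≤ k ∧ k ≤ n ∧ k ≤ q ∧ p ≤ pval w k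

/-- Condition B at `(p,q)`: there is no `k` with `k > q` and `w(k) < p`. -/
def CondB {n : ℕ} (w : Equiv.Perm (Fin n)) (p q : ℕ) : Prop :=
  ¬ ∃ k, 1 ≤ k ∧ k ≤ n ∧ q < k ∧ pval w k < p

/-- `w` is defined by inclusions if every essential set box satisfies Condition A or B. -/
def DefinedByInclusions {n : ℕ} (w : Equiv.Perm (Fin n)) : Prop :=
  ∀ p q, (p, q) ∈ EssSet w → CondA w p q ∨ CondB w p q

/-- Condition W at `(p,q) ∈ E(w)`. -/
def CondW {n : ℕ} (w : Equiv.Perm (Fin n)) (p q : ℕ) : Prop :=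
  (∀ p' < p, (p', q) ∉ EssSet w) ∧
    ((p, q - 1) ∉ Diagram w ∨
      ∃ p' < p, (p', q - 1) ∈ EssSet w ∧ CondB w p' (q - 1) ∧
        rk w p' (q - 1) = rk w p q)

/-- Condition X at `(p,q) ∈ E(w)`. -/
def CondX {n : ℕ} (w : Equiv.Perm (Fin n)) (p q : ℕ) : Prop :=
  ∃ p' < p, (p', q) ∈ EssSet w ∧ (∀ p'' < p, (p'', q) ∈ EssSet w → p'' = p') ∧
    CondB w p' q ∧ rk w p' q = rk w p q + 1 ∧
    ∃ q', IsLeast {c | ∀ b, c ≤ b → b ≤ q → (p', b) ∈ Diagram w} q' ∧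
      (p, q' - 1) ∈ Diagram w

/-- Condition Y at `(p,q) ∈ E(w)`. -/
def CondY {n : ℕ} (w : Equiv.Perm (Fin n)) (p q : ℕ) : Prop :=
  (∀ q' > q, (p, q') ∉ EssSet w) ∧
    ((p + 1, q) ∉ Diagram w ∨
      ∃ q' > q, (p + 1, q') ∈ EssSet w ∧ CondB w (p + 1) q' ∧
        rk w (p + 1) q' = rk w p q)

/-- Condition Z at `(p,q) ∈ E(w)`. -/
def CondZ {n : ℕ} (w : Equiv.Perm (Fin n)) (p q : ℕ) : Prop :=
  ∃ q' > q, (p, q') ∈ EssSet w ∧ (∀ q'' > q, (p, q'') ∈ EssSet w → q'' = q') ∧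
    CondB w p q' ∧ rk w p q' = rk w p q + 1 ∧
    ∃ p', IsGreatest {c | ∀ a, p ≤ a → a ≤ c → (a, q') ∈ Diagram w} p' ∧
      (p' + 1, q) ∈ Diagram w

/-- `w` is almost defined by inclusions if every essential box satisfies Condition A or B,
or satisfies both one of Conditions W and X and one of Conditions Y and Z. -/
def AlmostDBI {n : ℕ} (w : Equiv.Perm (Fin n)) : Prop :=
  ∀ p q, (p, q) ∈ EssSet w →
    (CondA w p q ∨ CondB w p q) ∨
      ((CondW w p q ∨ CondX w p q) ∧ (CondY w p q ∨ CondZ w p q))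
/-- `E″(w)`: the essential boxes satisfying neither Condition A nor Condition B. -/
def EssSet'' {n : ℕ} (w : Equiv.Perm (Fin n)) : Set (ℕ × ℕ) :=
  {pq | pq ∈ EssSet w ∧ ¬ CondA w pq.1 pq.2 ∧ ¬ CondB w pq.1 pq.2}

/-- `ℓ(w)`: the number of inversions of `w`. -/
def ell {n : ℕ} (w : Equiv.Perm (Fin n)) : ℕ :=
  (Finset.univ.filter fun ij : Fin n × Fin n => ij.1 < ij.2 ∧ w ij.2 < w ij.1).card

section Basic

variable {n : ℕ} (w : Equiv.Perm (Fin n))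

theorem pval_pos {k : ℕ} (h1 : 1 ≤ k) (h2 : k ≤ n) : 1 ≤ pval w k := by
  simp [pval, h1, h2]

theorem pval_le (k : ℕ) : pval w k ≤ n := by
  unfold pval
  split_ifs with h
  · exact (w _).isLt
  · exact Nat.zero_le _

theorem pval_symm_pval {k : ℕ} (h1 : 1 ≤ k) (h2 : k ≤ n) : pval w.symm (pval w k) = k := by
  have h3 := pval_pos w h1 h2
  have h4 := pval_le w k
  rw [pval, dif_pos ⟨h3, h4⟩]
  simp only [pval, h1, h2, and_self, dite_true, Nat.add_sub_cancel, Fin.eta,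
    Equiv.symm_apply_apply]
  omega

theorem pval_pval_symm {k : ℕ} (h1 : 1 ≤ k) (h2 : k ≤ n) : pval w (pval w.symm k) = k :=
  pval_symm_pval w.symm h1 h2

theorem pval_ext {u v : Equiv.Perm (Fin n)}
    (h : ∀ k, 1 ≤ k → k ≤ n → pval u k = pval v k) : u = v := by
  ext x
  have hx := h (x + 1) (by omega) x.isLt
  have hlt : (x : ℕ) + 1 ≤ n := x.isLt
  simpa [pval, hlt] using hx

theorem mem_diagram_iff {p q : ℕ} : (p, q) ∈ Diagram w ↔
    1 ≤ p ∧ p ≤ n ∧ 1 ≤ q ∧ q ≤ n ∧ pval w q < p ∧ q < pval w.symm p := Iff.rfl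

/-- Essential boxes are the ascents of `w` at `q` lined up with ascents of `w⁻¹` at `p - 1`. -/
theorem mem_essSet_iff {p q : ℕ} : (p, q) ∈ EssSet w ↔
    1 ≤ q ∧ q < n ∧ 2 ≤ p ∧ p ≤ n ∧ pval w q < p ∧ p ≤ pval w (q + 1) ∧
      pval w.symm (p - 1) ≤ q ∧ q < pval w.symm p := by
  have hd : (p, q) ∈ EssSet w ↔
    ((p, q) ∈ Diagram w ∧ (p, q + 1) ∉ Diagram w ∧ (p - 1, q) ∉ Diagram w) := Iff.rfl
  rw [hd]
  simp only [mem_diagram_iff]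
  have a1 := pval_le w.symm p
  have a2 := @pval_pos n w q
  have a3 := @pval_pval_symm n w p
  have a4 := @pval_symm_pval n w q
  have a5 : 1 ≤ q → q ≤ n → p - 1 = pval w q → pval w.symm (p - 1) = q := by
    intro h1 h2 h3; rw [h3, a4 h1 h2]
  have a6 : 1 ≤ p → p ≤ n → q + 1 = pval w.symm p → pval w (q + 1) = p := by
    intro h1 h2 h3; rw [h3, a3 h1 h2]
  constructor
  · rintro ⟨⟨h1, h2, h3, h4, h5, h6⟩, h7, h8⟩
    have := a2 h3 h4
    have := a5 h3 h4
    have := a6 h1 h2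
    omega
  · omega

theorem essSet_finite : (EssSet w).Finite := by
  refine ((Finset.Icc 1 n) ×ˢ (Finset.Icc 1 n)).finite_toSet.subset ?_
  rintro ⟨p, q⟩ h
  have h := (mem_essSet_iff w).1 h
  simp only [Finset.coe_product, Finset.coe_Icc, Set.mem_prod, Set.mem_Icc]
  omega

theorem rk_zero (p : ℕ) : rk w p 0 = 0 := by
  rw [rk, Finset.card_eq_zero, Finset.filter_eq_empty_iff]
  intro k hk
  have := (Finset.mem_Icc.1 hk).1
  omega

theorem rk_succ (p : ℕ) {q : ℕ} (hq : q < n) :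
    rk w p (q + 1) = rk w p q + if p ≤ pval w (q + 1) then 1 else 0 := by
  unfold rk
  split_ifs with h
  · rw [← Finset.card_insert_of_notMem (a := q + 1) (by simp)]
    congr 1
    ext k
    simp only [Finset.mem_filter, Finset.mem_Icc, Finset.mem_insert]
    grind
  · refine (congrArg Finset.card ?_).trans (Nat.add_zero _).symm
    ext k
    simp only [Finset.mem_filter, Finset.mem_Icc]
    grind

theorem rk_eq_rk_succ_row {p q : ℕ} (h1 : 1 ≤ p) (h2 : p ≤ n) :
    rk w p q = rk w (p + 1) q + if pval w.symm p ≤ q then 1 else 0 := by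
  have b1 := pval_pos w.symm h1 h2
  have b2 := pval_le w.symm p
  have b3 := pval_pval_symm w h1 h2
  have b4 : ∀ k, 1 ≤ k → k ≤ n → pval w k = p → k = pval w.symm p := by
    rintro k h h' rfl
    exact (pval_symm_pval w h h').symm
  unfold rk
  split_ifs with h
  · rw [← Finset.card_insert_of_notMem (a := pval w.symm p) (by simp [b3])]
    congr 1
    ext k
    simp only [Finset.mem_filter, Finset.mem_Icc, Finset.mem_insert]
    grind
  · refine (congrArg Finset.card ?_).trans (Nat.add_zero _).symm
    ext k
    simp only [Finset.mem_filter, Finset.mem_Icc]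
    grind

theorem rk_eq_zero_of_lt {p q : ℕ} (h : n < p) : rk w p q = 0 := by
  rw [rk, Finset.card_eq_zero, Finset.filter_eq_empty_iff]
  intro k _
  have := pval_le w k
  omega

theorem rk_mono {p p' q q' : ℕ} (hp : p' ≤ p) (hq : q ≤ q') : rk w p q ≤ rk w p' q' := by
  refine Finset.card_le_card fun k => ?_
  simp only [Finset.mem_filter, Finset.mem_Icc]
  omega

/-- If the rank grows by at most one when the quadrant grows, then at most one dot is added. -/
theorem eq_of_rk_le_succ {p p' q q' k l : ℕ} (hp : p' ≤ p) (hq : q ≤ q')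
    (h : rk w p' q' ≤ rk w p q + 1) (hk : 1 ≤ k ∧ k ≤ n ∧ k ≤ q' ∧ p' ≤ pval w k)
    (hk' : ¬(k ≤ q ∧ p ≤ pval w k)) (hl : 1 ≤ l ∧ l ≤ n ∧ l ≤ q' ∧ p' ≤ pval w l)
    (hl' : ¬(l ≤ q ∧ p ≤ pval w l)) : k = l := by
  by_contra hne
  have hsub : insert k (insert l ((Finset.Icc 1 n).filter fun k => k ≤ q ∧ p ≤ pval w k)) ⊆
      (Finset.Icc 1 n).filter fun k => k ≤ q' ∧ p' ≤ pval w k := by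
    intro x
    simp only [Finset.mem_filter, Finset.mem_Icc, Finset.mem_insert]
    rintro (rfl | rfl | hx) <;> omega
  have hc := Finset.card_le_card hsub
  rw [Finset.card_insert_of_notMem (by simp [hne]; omega),
    Finset.card_insert_of_notMem (by simp; omega)] at hc
  unfold rk at h
  omega

/-- If the rank does not grow when the quadrant grows, then no dot is added. -/
theorem mem_quadrant_of_rk_le {p p' q q' k : ℕ} (hp : p' ≤ p) (hq : q ≤ q')
    (h : rk w p' q' ≤ rk w p q) (hk : 1 ≤ k ∧ k ≤ n ∧ k ≤ q' ∧ p' ≤ pval w k) :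
    k ≤ q ∧ p ≤ pval w k := by
  by_contra hk'
  have hsub : insert k ((Finset.Icc 1 n).filter fun k => k ≤ q ∧ p ≤ pval w k) ⊆
      (Finset.Icc 1 n).filter fun k => k ≤ q' ∧ p' ≤ pval w k := by
    intro x
    simp only [Finset.mem_filter, Finset.mem_Icc, Finset.mem_insert]
    rintro (rfl | hx) <;> omega
  have hc := Finset.card_le_card hsub
  rw [Finset.card_insert_of_notMem (by simp; omega)] at hc
  unfold rk at h
  omega

end Basic

section Uniqueness

variable {n : ℕ} {u v : Equiv.Perm (Fin n)}

theorem rk_le_of_mem_diagram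
    (h : ∀ pq ∈ EssSet v, rk u pq.1 pq.2 ≤ rk v pq.1 pq.2) {p q : ℕ}
    (hpq : (p, q) ∈ Diagram v) : rk u p q ≤ rk v p q := by
  induction hm : (n - q) + p using Nat.strong_induction_on generalizing p q with
  | _ m ih =>
    have hb := (mem_diagram_iff v).1 hpq
    by_cases h1 : (p, q + 1) ∈ Diagram v
    · have hb1 := (mem_diagram_iff v).1 h1
      have e := rk_succ v p (q := q) (by omega)
      rw [if_neg (by omega)] at e
      have := ih _ (by omega) h1 rfl
      have := rk_mono u (le_refl p) (Nat.le_succ q)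
      grind
    · by_cases h2 : (p - 1, q) ∈ Diagram v
      · have hb2 := (mem_diagram_iff v).1 h2
        have e := rk_eq_rk_succ_row v (p := p - 1) (q := q) (by omega) (by omega)
        rw [if_neg (by omega), Nat.sub_add_cancel (by omega)] at e
        have := ih _ (by omega) h2 rfl
        have := rk_mono u (Nat.sub_le p 1) (le_refl q)
        omega
      · exact h (p, q) ⟨hpq, h1, h2⟩

/-- Rank inequalities propagate from the essential set to the whole matrix. -/
theorem rk_le_of_essSet
    (h : ∀ pq ∈ EssSet v, rk u pq.1 pq.2 ≤ rk v pq.1 pq.2) {p q : ℕ}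
    (hp : 1 ≤ p) (hq : q ≤ n) : rk u p q ≤ rk v p q := by
  induction hm : q + (n + 1 - p) using Nat.strong_induction_on generalizing p q with
  | _ m ih =>
    by_cases hD : (p, q) ∈ Diagram v
    · exact rk_le_of_mem_diagram h hD
    by_cases hpn : n < p
    · rw [rk_eq_zero_of_lt u hpn]; exact Nat.zero_le _
    obtain _ | q := q
    · rw [rk_zero]; exact Nat.zero_le _
    rw [mem_diagram_iff] at hD
    by_cases h1 : p ≤ pval v (q + 1)
    · have e := rk_succ v p (q := q) (by omega)
      have e' := rk_succ u p (q := q) (by omega)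
      have := ih (q + (n + 1 - p)) (by omega) hp (by omega) rfl
      grind
    · have e := rk_eq_rk_succ_row v (p := p) (q := q + 1) (by omega) (by omega)
      have e' := rk_eq_rk_succ_row u (p := p) (q := q + 1) (by omega) (by omega)
      have := ih (q + 1 + (n + 1 - (p + 1))) (by omega) (by omega) hq rfl
      grind

/-- A permutation is determined by its essential set and the ranks there. -/
theorem eq_of_essSet_eq (hE : EssSet u = EssSet v)
    (h : ∀ pq ∈ EssSet v, rk u pq.1 pq.2 = rk v pq.1 pq.2) : u = v := by
  have hr : ∀ p q, 1 ≤ p → q ≤ n → rk u p q = rk v p q := fun p q hp hq =>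
    le_antisymm (rk_le_of_essSet (fun x hx => (h x hx).le) hp hq)
      (rk_le_of_essSet (fun x hx => (h x (hE ▸ hx)).ge) hp hq)
  have key : ∀ p k, 1 ≤ p → 1 ≤ k → k ≤ n → (p ≤ pval u k ↔ p ≤ pval v k) := by
    intro p k hp hk hkn
    obtain ⟨q, rfl⟩ : ∃ q, k = q + 1 := ⟨k - 1, by omega⟩
    have e := rk_succ v p (q := q) (by omega)
    have e' := rk_succ u p (q := q) (by omega)
    have := hr p q hp (by omega)
    have := hr p (q + 1) hp hkn
    grind
  refine pval_ext fun k hk hkn => ?_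
  have h1 := (key _ k (pval_pos u hk hkn) hk hkn).1 le_rfl
  have h2 := (key _ k (pval_pos v hk hkn) hk hkn).2 le_rfl
  omega

end Uniqueness

section Swap

variable {n : ℕ}

/-- `v` is obtained from `w` by exchanging the values at positions `i < j`, in ascending order
in `w`. -/
structure IsSwap (w v : Equiv.Perm (Fin n)) (i j : ℕ) : Prop where
  one_le : 1 ≤ i
  lt : i < j
  le : j ≤ n
  val_lt : pval w i < pval w j
  left : pval v i = pval w j
  right : pval v j = pval w i
  other : ∀ k, k ≠ i → k ≠ j → pval v k = pval w k
  symm_left : pval v.symm (pval w i) = j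
  symm_right : pval v.symm (pval w j) = i
  symm_other : ∀ a, a ≠ pval w i → a ≠ pval w j → pval v.symm a = pval w.symm a

theorem exists_isSwap (w : Equiv.Perm (Fin n)) {i j : ℕ} (hi : 1 ≤ i) (hij : i < j)
    (hj : j ≤ n) (h : pval w i < pval w j) : ∃ v, IsSwap w v i j := by
  let x : Fin n := ⟨i - 1, by omega⟩
  let y : Fin n := ⟨j - 1, by omega⟩
  let v : Equiv.Perm (Fin n) := (Equiv.swap x y).trans w
  have hl : pval v i = pval w j := by
    have h1 : 1 ≤ i ∧ i ≤ n := by omega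
    have h2 : 1 ≤ j ∧ j ≤ n := by omega
    simp only [pval, h1, h2, and_self, dite_true]
    change ((w (Equiv.swap x y x) : Fin n) : ℕ) + 1 = _
    rw [Equiv.swap_apply_left]
  have hr : pval v j = pval w i := by
    have h1 : 1 ≤ i ∧ i ≤ n := by omega
    have h2 : 1 ≤ j ∧ j ≤ n := by omega
    simp only [pval, h1, h2, and_self, dite_true]
    change ((w (Equiv.swap x y y) : Fin n) : ℕ) + 1 = _
    rw [Equiv.swap_apply_right]
  have ho : ∀ k, k ≠ i → k ≠ j → pval v k = pval w k := by
    intro k h1 h2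
    unfold pval
    split_ifs with hk
    · change ((w (Equiv.swap x y _) : Fin n) : ℕ) + 1 = _
      rw [Equiv.swap_apply_of_ne_of_ne]
      · simp only [x, ne_eq, Fin.mk.injEq]; omega
      · simp only [y, ne_eq, Fin.mk.injEq]; omega
    · rfl
  refine ⟨v, hi, hij, hj, h, hl, hr, ho, ?_, ?_, ?_⟩
  · rw [← hr]; exact pval_symm_pval v (by omega) (by omega)
  · rw [← hl]; exact pval_symm_pval v (by omega) (by omega)
  · intro a h1 h2
    by_cases ha : 1 ≤ a ∧ a ≤ n
    · have e := pval_pval_symm w ha.1 ha.2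
      have b1 := pval_pos w.symm ha.1 ha.2
      have b2 := pval_le w.symm a
      have e2 := ho (pval w.symm a) (by rintro h; rw [h] at e; omega)
        (by rintro h; rw [h] at e; omega)
      rw [e] at e2
      have e3 := pval_symm_pval v b1 b2
      rwa [e2] at e3
    · simp only [pval, ha, dite_false]

variable {w v : Equiv.Perm (Fin n)} {i j : ℕ}

theorem IsSwap.rk_eq (hs : IsSwap w v i j) (a : ℕ) {b : ℕ} (hb : b ≤ n) :
    rk v a b = rk w a b + if pval w i < a ∧ a ≤ pval w j ∧ i ≤ b ∧ b < j then 1 else 0 := by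
  obtain ⟨h1, h2, h3, h4, h5, h6, h7, -, -, -⟩ := hs
  induction b with
  | zero => rw [rk_zero, rk_zero, if_neg (by omega)]
  | succ b ih =>
    rw [rk_succ v a hb, rk_succ w a hb, ih (by omega)]
    have := h7 (b + 1)
    by_cases e1 : b + 1 = i
    · subst e1; rw [h5]; split_ifs <;> omega
    · by_cases e2 : b + 1 = j
      · subst e2; rw [h6]; split_ifs <;> omega
      · rw [this e1 e2]; split_ifs <;> omega

end Swap

section Length

variable {n : ℕ}

theorem ell_eq_sum_rk (w : Equiv.Perm (Fin n)) :
    ell w = ∑ k ∈ Finset.Icc 1 n, rk w (pval w k + 1) k := by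
  have hfin : ell w = ∑ y : Fin n, rk w (pval w (y + 1) + 1) (y + 1) := by
    unfold ell
    rw [Finset.card_filter, Fintype.sum_prod_type_right]
    refine Finset.sum_congr rfl fun y _ => ?_
    rw [← Finset.card_filter]
    unfold rk
    refine Finset.card_bij (fun x _ => (x : ℕ) + 1) ?_ ?_ ?_
    · intro x hx
      have hx := (Finset.mem_filter.1 hx).2
      have hxn : (x : ℕ) + 1 ≤ n := x.isLt
      have hyn : (y : ℕ) + 1 ≤ n := y.isLt
      simp only [Fin.lt_def] at hx
      simp [pval, hxn, hyn]
      omega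
    · intro x _ x' _ h
      exact Fin.ext (by omega)
    · intro k hk
      simp only [Finset.mem_filter, Finset.mem_Icc] at hk
      obtain ⟨⟨h1, h2⟩, h3, h4⟩ := hk
      have hyn : (y : ℕ) + 1 ≤ n := y.isLt
      refine ⟨⟨k - 1, by omega⟩, ?_, by simp; omega⟩
      simp [pval, h1, h2, hyn] at h4
      have hne : (⟨k - 1, by omega⟩ : Fin n) ≠ y := fun h => by
        rw [h] at h4; exact lt_irrefl _ h4
      have : k - 1 ≠ (y : ℕ) := fun h => hne (Fin.ext h)
      simp only [Finset.mem_filter, Finset.mem_univ, true_and, Fin.lt_def]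
      omega
  rw [hfin, Fin.sum_univ_eq_sum_range (fun y => rk w (pval w (y + 1) + 1) (y + 1)) n,
    Finset.sum_bij (fun k _ => k + 1)]
  · intro k hk; simp at hk ⊢; omega
  · intro a _ b _ h; omega
  · intro k hk
    simp at hk
    exact ⟨k - 1, by simp; omega, by omega⟩
  · intros; rfl

/-- Exchanging the dots of a cover in Bruhat order raises the length by one. -/
theorem IsSwap.ell_eq {w v : Equiv.Perm (Fin n)} {i j : ℕ} (hs : IsSwap w v i j)
    (hc : ∀ k, i < k → k < j → pval w k < pval w i ∨ pval w j < pval w k) :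
    ell v = ell w + 1 := by
  have hi : i ∈ Finset.Icc 1 n := Finset.mem_Icc.2 ⟨hs.one_le, hs.lt.le.trans hs.le⟩
  have hj : j ∈ (Finset.Icc 1 n).erase i := by
    have := hs.one_le; have := hs.lt; have := hs.le
    simp; omega
  have hstep : ∀ m, i ≤ m → m < j → rk w (pval w i + 1) m + rk w (pval w j + 1) i =
      rk w (pval w j + 1) m + rk w (pval w i + 1) i := by
    intro m hm
    induction m, hm using Nat.le_induction with
    | base => intro _; omega
    | succ m hm ih =>
      intro hmj
      have := ih (by omega)
      have := hc (m + 1) (by omega) hmj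
      have := hs.le
      have := hs.val_lt
      rw [rk_succ w _ (by omega), rk_succ w _ (by omega)]
      split_ifs <;> omega
  obtain ⟨m, rfl⟩ : ∃ m, j = m + 1 := ⟨j - 1, by have := hs.lt; omega⟩
  have hm := hstep m (by have := hs.lt; omega) (by omega)
  have hle := hs.le
  have hlt := hs.lt
  have hval := hs.val_lt
  have e1 := rk_succ w (pval w i + 1) (q := m) (by omega)
  have e2 := rk_succ w (pval w (m + 1) + 1) (q := m) (by omega)
  rw [ell_eq_sum_rk, ell_eq_sum_rk, ← Finset.add_sum_erase _ _ hi, ← Finset.add_sum_erase _ _ hj,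
    ← Finset.add_sum_erase _ _ hi, ← Finset.add_sum_erase _ _ hj]
  have hrest : ∀ k ∈ ((Finset.Icc 1 n).erase i).erase (m + 1),
      rk v (pval v k + 1) k = rk w (pval w k + 1) k := by
    intro k hk
    simp only [Finset.mem_erase, Finset.mem_Icc] at hk
    rw [hs.other k hk.2.1 hk.1, hs.rk_eq _ hk.2.2.2]
    have := hc k
    rw [if_neg]
    · rfl
    · omega
  rw [Finset.sum_congr rfl hrest, hs.left, hs.right, hs.rk_eq _ (by omega), hs.rk_eq _ (by omega)]
  split_ifs at * <;> omega

end Length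

section Pivot

variable {n : ℕ}

/-- The dot `(w(i), i)` weakly to the left of and above the essential box `(p,q)` which gets
exchanged when this box is removed. -/
structure LeftPivot (w : Equiv.Perm (Fin n)) (p q i : ℕ) : Prop where
  one_le : 1 ≤ i
  le : i ≤ q
  val_lt : pval w i < p
  cols : ∀ b, i < b → b ≤ q → pval w b < pval w i
  rows : ∀ a, pval w i < a → a < p → pval w.symm a < i
  corner : i = q ∨ p = pval w i + 1
  left : p = pval w i + 1 ∨ i = 1 ∨ p ≤ pval w (i - 1)
  above : i = q ∨ pval w i = 1 ∨ q < pval w.symm (pval w i - 1)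
  condB : ∀ b, i < b → b ≤ q → (pval w i - 1, b) ∈ EssSet w → CondB w (pval w i - 1) b

/-- The dot `(w(j), j)` to the right of and weakly below the essential box `(p,q)` which gets
exchanged when this box is removed. -/
structure RightPivot (w : Equiv.Perm (Fin n)) (p q j : ℕ) : Prop where
  lt : q < j
  le : j ≤ n
  le_val : p ≤ pval w j
  rows : ∀ a, p ≤ a → a < pval w j → j < pval w.symm a
  cols : ∀ b, q < b → b < j → pval w j < pval w b
  below : j = q + 1 ∨ pval w j = n ∨ pval w.symm (pval w j + 1) ≤ q
  right : p = pval w j ∨ j = n ∨ pval w (j + 1) < p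
  condB : ∀ a, p ≤ a → a < pval w j → (a, j + 1) ∈ EssSet w → CondB w a (j + 1)

variable {w : Equiv.Perm (Fin n)} {p q : ℕ}

theorem notMem_diagram_of_forall_notMem_essSet_col (hE : (p, q) ∈ EssSet w)
    (h : ∀ p' < p, (p', q) ∉ EssSet w) {a : ℕ} (ha : a < p) : (a, q) ∉ Diagram w := by
  rw [mem_essSet_iff] at hE
  induction a with
  | zero => rw [mem_diagram_iff]; omega
  | succ a ih =>
    intro hD
    have h1 := h (a + 1) ha
    have h2 := ih (by omega)
    rw [mem_essSet_iff] at h1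
    rw [mem_diagram_iff] at hD h2
    have := pval_pos w (k := q) (by omega) (by omega)
    have h3 := pval_symm_pval w (k := q) (by omega) (by omega)
    by_cases ha : pval w q = a
    · rw [ha] at h3; simp only [Nat.add_sub_cancel] at h1; omega
    · simp only [Nat.add_sub_cancel] at h1; omega

theorem notMem_diagram_of_forall_notMem_essSet_row (hE : (p, q) ∈ EssSet w)
    (h : ∀ q' > q, (p, q') ∉ EssSet w) {b : ℕ} (hb : q < b) : (p, b) ∉ Diagram w := by
  rw [mem_essSet_iff] at hE
  by_cases hbn : n < b
  · rw [mem_diagram_iff]; omega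
  induction hm : n - b using Nat.strong_induction_on generalizing b with
  | _ m ih =>
    intro hD
    rw [mem_diagram_iff] at hD
    have h0 := pval_le w.symm p
    have h1 := h b hb
    have h2 := ih (n - (b + 1)) (by omega) (b := b + 1) (by omega) (by omega) rfl
    rw [mem_essSet_iff] at h1
    rw [mem_diagram_iff] at h2
    have h3 := pval_pval_symm w (k := p) (by omega) (by omega)
    by_cases ha : pval w.symm p = b + 1
    · rw [ha] at h3; omega
    · omega

theorem CondW.leftPivot (hE : (p, q) ∈ EssSet w) (h : CondW w p q) : LeftPivot w p q q := by
  obtain ⟨h1, h2⟩ := h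
  have hcol := fun a ha => notMem_diagram_of_forall_notMem_essSet_col hE h1 (a := a) ha
  have hE' := (mem_essSet_iff w).1 hE
  have hs := pval_symm_pval w (k := q) (by omega) (by omega)
  refine ⟨by omega, le_rfl, by omega, by omega, ?_, Or.inl rfl, ?_, Or.inl rfl, by omega⟩
  · intro a ha hap
    have h3 := hcol a hap
    rw [mem_diagram_iff] at h3
    have h4 := pval_pval_symm w (k := a) (by omega) (by omega)
    by_contra hlt
    have : pval w.symm a = q := by omega
    rw [this] at h4
    omega
  · rcases h2 with h2 | ⟨p', hp', h3, -, h4⟩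
    · rw [mem_diagram_iff] at h2
      omega
    · left
      rw [mem_essSet_iff] at h3
      obtain ⟨r, rfl⟩ : ∃ r, q = r + 1 := ⟨q - 1, by omega⟩
      have e := rk_succ w p (q := r) (by omega)
      rw [if_neg (by omega)] at e
      rw [Nat.add_sub_cancel] at h3 h4
      have h5 := pval_pval_symm w (k := p - 1) (by omega) (by omega)
      have h6 := pval_pos w.symm (k := p - 1) (by omega) (by omega)
      by_contra hne
      have := mem_quadrant_of_rk_le w (p := p) (p' := p') (q := r) (q' := r)
        (k := pval w.symm (p - 1)) (by omega) le_rfl (by omega) (by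
          refine ⟨h6, pval_le _ _, ?_, by omega⟩
          by_contra hr
          have : pval w.symm (p - 1) = r + 1 := by omega
          rw [this] at h5
          omega)
      omega

theorem CondY.rightPivot (hE : (p, q) ∈ EssSet w) (h : CondY w p q) :
    RightPivot w p q (pval w.symm p) := by
  obtain ⟨h1, h2⟩ := h
  have hrow := fun b hb => notMem_diagram_of_forall_notMem_essSet_row hE h1 (b := b) hb
  have hE' := (mem_essSet_iff w).1 hE
  have hs := pval_pval_symm w (k := p) (by omega) (by omega)
  have hle := pval_le w.symm p
  refine ⟨by omega, hle, hs.ge, by omega, ?_, ?_, Or.inl hs.symm, by omega⟩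
  · intro b hb hbj
    rw [hs]
    have h3 := hrow b hb
    rw [mem_diagram_iff] at h3
    have h4 := pval_symm_pval w (k := b) (by omega) (by omega)
    by_contra hlt
    have : pval w b = p := by omega
    rw [this] at h4
    omega
  · rw [hs]
    rcases h2 with h2 | ⟨q', hq', h3, -, h4⟩
    · rw [mem_diagram_iff] at h2
      omega
    · left
      rw [mem_essSet_iff] at h3
      have e := rk_eq_rk_succ_row w (p := p) (q := q) (by omega) (by omega)
      rw [if_neg (by omega)] at e
      by_contra hne
      have := mem_quadrant_of_rk_le w (p := p + 1) (p' := p + 1) (q := q) (q' := q')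
        (k := q + 1) (by omega) (by omega) (by omega) (by
          refine ⟨by omega, by omega, by omega, ?_⟩
          by_contra hr
          have hp : pval w (q + 1) = p := by omega
          have h5 := pval_symm_pval w (k := q + 1) (by omega) (by omega)
          rw [hp] at h5
          omega)
      omega

/-- Condition X in terms of dots rather than boxes of the diagram. -/
theorem condX_iff (hE : (p, q) ∈ EssSet w) : CondX w p q ↔
    ∃ p' < p, (p', q) ∈ EssSet w ∧ (∀ p'' < p, (p'', q) ∈ EssSet w → p'' = p') ∧
      CondB w p' q ∧ rk w p' q = rk w p q + 1 ∧
      ∀ b, pval w.symm (p - 1) < b → b ≤ q → pval w b < p' := by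
  have hE' := (mem_essSet_iff w).1 hE
  have hs := pval_pval_symm w (k := p - 1) (by omega) (by omega)
  have hpos := pval_pos w.symm (k := p - 1) (by omega) (by omega)
  refine exists_congr fun p' => and_congr_right fun hp' => and_congr_right fun h1 =>
    and_congr_right fun _ => and_congr_right fun _ => and_congr_right fun h2 => ?_
  rw [mem_essSet_iff] at h1
  constructor
  · rintro ⟨c, ⟨hc, hlow⟩, hD⟩ b hb hbq
    rw [mem_diagram_iff] at hD
    have hnot : (p', c - 1) ∉ Diagram w := fun hmem => by
      have : c ≤ c - 1 := hlow fun b hb hbq => by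
        by_cases hbc : b = c - 1
        · rwa [hbc]
        · exact hc b (by omega) hbq
      omega
    rw [mem_diagram_iff] at hnot
    have hcq : c ≤ q := by
      refine hlow fun b hb hbq => ?_
      have : b = q := le_antisymm hbq hb
      rw [this, mem_diagram_iff]
      omega
    have heq := eq_of_rk_le_succ w (p := p) (p' := p') (q := q) (q' := q)
      (k := c - 1) (l := pval w.symm (p - 1)) (by omega) le_rfl (by omega) (by omega) (by omega)
      (by omega) (by omega)
    have := hc b (by omega) hbq
    rw [mem_diagram_iff] at this
    omega
  · intro h
    refine ⟨pval w.symm (p - 1) + 1, ⟨fun b hb hbq => ?_, fun c hc => ?_⟩, ?_⟩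
    · have := h b (by omega) hbq
      rw [mem_diagram_iff]
      omega
    · by_contra hlt
      have := hc (pval w.symm (p - 1)) (by omega) (by omega)
      rw [mem_diagram_iff] at this
      omega
    · rw [mem_diagram_iff, Nat.add_sub_cancel]
      omega

/-- Condition Z in terms of dots rather than boxes of the diagram. -/
theorem condZ_iff (hE : (p, q) ∈ EssSet w) : CondZ w p q ↔
    ∃ q' > q, (p, q') ∈ EssSet w ∧ (∀ q'' > q, (p, q'') ∈ EssSet w → q'' = q') ∧
      CondB w p q' ∧ rk w p q' = rk w p q + 1 ∧
      ∀ a, p ≤ a → a < pval w (q + 1) → q' < pval w.symm a := by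
  have hE' := (mem_essSet_iff w).1 hE
  have hs := pval_symm_pval w (k := q + 1) (by omega) (by omega)
  have hle := pval_le w (q + 1)
  refine exists_congr fun q' => and_congr_right fun hq' => and_congr_right fun h1 =>
    and_congr_right fun _ => and_congr_right fun _ => and_congr_right fun h2 => ?_
  rw [mem_essSet_iff] at h1
  constructor
  · rintro ⟨c, ⟨hc, hup⟩, hD⟩ a ha hat
    rw [mem_diagram_iff] at hD
    have hnot : (c + 1, q') ∉ Diagram w := fun hmem => by
      have : c + 1 ≤ c := hup fun a ha hac => by
        by_cases hbc : a = c + 1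
        · rwa [hbc]
        · exact hc a ha (by omega)
      omega
    rw [mem_diagram_iff] at hnot
    have hcp : p ≤ c := by
      refine hup fun a ha hac => ?_
      have : a = p := le_antisymm hac ha
      rw [this, mem_diagram_iff]
      omega
    have h3 := pval_pval_symm w (k := c + 1) (by omega) (by omega)
    have heq := eq_of_rk_le_succ w (p := p) (p' := p) (q := q) (q' := q')
      (k := q + 1) (l := pval w.symm (c + 1)) le_rfl (by omega) (by omega) (by omega) (by omega)
      (by omega) (by omega)
    rw [← heq] at h3
    have := hc a ha (by omega)
    rw [mem_diagram_iff] at this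
    omega
  · intro h
    refine ⟨pval w (q + 1) - 1, ⟨fun a ha hac => ?_, fun c hc => ?_⟩, ?_⟩
    · have := h a ha (by omega)
      rw [mem_diagram_iff]
      omega
    · by_contra hlt
      have := hc (pval w (q + 1)) (by omega) (by omega)
      rw [mem_diagram_iff] at this
      omega
    · rw [mem_diagram_iff, Nat.sub_add_cancel (by omega)]
      omega

theorem CondX.leftPivot (hE : (p, q) ∈ EssSet w) (h : CondX w p q) :
    LeftPivot w p q (pval w.symm (p - 1)) := by
  obtain ⟨p', hp', h1, huniq, hB, h2, h3⟩ := (condX_iff hE).1 h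
  have hE' := (mem_essSet_iff w).1 hE
  have h1' := (mem_essSet_iff w).1 h1
  have hs := pval_pval_symm w (k := p - 1) (by omega) (by omega)
  have hpos := pval_pos w.symm (k := p - 1) (by omega) (by omega)
  have hq := h3 q
  have hiq : pval w.symm (p - 1) ≠ q := by
    intro e; rw [e] at hs; omega
  have hp'1 : p' < p - 1 := by
    by_contra hge
    have : p' = p - 1 := by omega
    rw [← this] at hE'
    omega
  refine ⟨hpos, by omega, by omega, ?_, by omega, by omega, by omega, ?_, ?_⟩
  · intro b hb hbq
    have := h3 b hb hbq
    omega
  · rw [hs]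
    right; right
    by_contra hle
    have h4 := pval_pval_symm w (k := p - 1 - 1) (by omega) (by omega)
    have h5 := pval_pos w.symm (k := p - 1 - 1) (by omega) (by omega)
    have heq := eq_of_rk_le_succ w (p := p) (p' := p') (q := q) (q' := q)
      (k := pval w.symm (p - 1 - 1)) (l := pval w.symm (p - 1)) (by omega) le_rfl (by omega)
      (by omega) (by omega) (by omega) (by omega)
    rw [heq] at h4
    omega
  · rw [hs]
    intro b hb hbq hEb
    by_cases hbq' : b = q
    · subst hbq'
      rwa [huniq _ (by omega) hEb]
    · have := h3 (b + 1) (by omega) (by omega)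
      rw [mem_essSet_iff] at hEb
      omega

theorem CondZ.rightPivot (hE : (p, q) ∈ EssSet w) (h : CondZ w p q) :
    RightPivot w p q (q + 1) := by
  obtain ⟨q', hq', h1, huniq, hB, h2, h3⟩ := (condZ_iff hE).1 h
  have hE' := (mem_essSet_iff w).1 hE
  have h1' := (mem_essSet_iff w).1 h1
  have hs := pval_symm_pval w (k := q + 1) (by omega) (by omega)
  have hle := pval_le w (q + 1)
  have hq'1 : q + 1 < q' := by
    by_contra hge
    have : q' = q + 1 := by omega
    rw [this] at h1'
    omega
  refine ⟨by omega, by omega, by omega, ?_, by omega, Or.inl rfl, ?_, ?_⟩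
  · intro a ha hat
    have := h3 a ha hat
    omega
  · right; right
    by_contra hge
    have heq := eq_of_rk_le_succ w (p := p) (p' := p) (q := q) (q' := q')
      (k := q + 1) (l := q + 1 + 1) le_rfl (by omega) (by omega)
      (by omega) (by omega) (by omega) (by omega)
    omega
  · intro a ha hat hEa
    by_cases hap : a = p
    · subst hap
      rwa [huniq _ (by omega) hEa]
    · have := h3 (a - 1) (by omega) (by omega)
      rw [mem_essSet_iff] at hEa
      omega

end Pivot

section Removal

variable {n : ℕ} {w v : Equiv.Perm (Fin n)} {p q i j : ℕ}

/-- The only essential box of `w` in the rectangle spanned by the two pivots is `(p,q)`. -/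
theorem eq_of_mem_essSet_of_mem_rect (hL : LeftPivot w p q i)
    (hR : RightPivot w p q j) {a b : ℕ} (hab : (a, b) ∈ EssSet w) (ha : pval w i < a)
    (ha' : a ≤ pval w j) (hb : i ≤ b) (hb' : b < j) : a = p ∧ b = q := by
  rw [mem_essSet_iff] at hab
  have r1 := hL.rows a ha
  have r2 := hL.cols (b + 1)
  have r3 := hR.cols b
  have r4 := hR.rows (a - 1)
  omega

theorem IsSwap.val_cases (hs : IsSwap w v i j) (k : ℕ) :
    (k = i ∧ pval w k = pval w i ∧ pval v k = pval w j) ∨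
      (k = j ∧ pval w k = pval w j ∧ pval v k = pval w i) ∨
      (k ≠ i ∧ k ≠ j ∧ pval v k = pval w k) := by
  have := hs.other k
  by_cases h1 : k = i
  · subst h1; exact Or.inl ⟨rfl, rfl, hs.left⟩
  · by_cases h2 : k = j
    · subst h2; exact Or.inr (Or.inl ⟨rfl, rfl, hs.right⟩)
    · exact Or.inr (Or.inr ⟨h1, h2, this h1 h2⟩)

theorem IsSwap.symm_cases (hs : IsSwap w v i j) (a : ℕ) :
    (a = pval w i ∧ pval w.symm a = i ∧ pval v.symm a = j) ∨
      (a = pval w j ∧ pval w.symm a = j ∧ pval v.symm a = i) ∨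
      (a ≠ pval w i ∧ a ≠ pval w j ∧ pval v.symm a = pval w.symm a) := by
  have hi := hs.one_le
  have hij := hs.lt
  have hj := hs.le
  have := hs.symm_other a
  by_cases h1 : a = pval w i
  · subst h1
    exact Or.inl ⟨rfl, pval_symm_pval w (by omega) (by omega), hs.symm_left⟩
  · by_cases h2 : a = pval w j
    · subst h2
      exact Or.inr (Or.inl ⟨rfl, pval_symm_pval w (by omega) (by omega), hs.symm_right⟩)
    · exact Or.inr (Or.inr ⟨h1, h2, this h1 h2⟩)

theorem IsSwap.mem_essSet_of_mem (hs : IsSwap w v i j)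
    (hL : LeftPivot w p q i) (hR : RightPivot w p q j)
    {a b : ℕ} (hv : (a, b) ∈ EssSet v) : (a, b) ∈ EssSet w ∧ ¬(a = p ∧ b = q) := by
  obtain ⟨L1, L2, L3, L4, L5, L6, L7, L8, -⟩ := hL
  obtain ⟨R1, R2, R3, R4, R5, R6, R7, -⟩ := hR
  rw [mem_essSet_iff] at hv
  obtain ⟨v1, v2, v3, v4, v5, v6, v7, v8⟩ := hv
  have g1 : pval w b < a := by
    have := L5 a
    rcases hs.val_cases b with h1 | h1 | h1
    · omega
    · obtain ⟨rfl, -, h1⟩ := h1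
      rw [hs.other (b + 1) (by omega) (by omega)] at v6
      rcases hs.symm_cases a with h3 | h3 | h3 <;> omega
    · omega
  have g2 : a ≤ pval w (b + 1) := by
    have := R4 (a - 1)
    rcases hs.val_cases (b + 1) with h2 | h2 | h2
    · obtain ⟨rfl, -, h2⟩ := h2
      rw [hs.other b (by omega) (by omega)] at v5
      rw [Nat.add_sub_cancel] at L7
      rcases hs.symm_cases (a - 1) with h4 | h4 | h4 <;> omega
    · omega
    · omega
  have g3 : pval w.symm (a - 1) ≤ b := by
    have := L4 (b + 1)
    rcases hs.symm_cases (a - 1) with h4 | h4 | h4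
    · omega
    · rw [← h4.1, Nat.sub_add_cancel (by omega)] at R6
      rw [hs.symm_other a (by omega) (by omega)] at v8
      rcases hs.val_cases (b + 1) with h2 | h2 | h2 <;> omega
    · omega
  have g4 : b < pval w.symm a := by
    have := R5 b
    rcases hs.symm_cases a with h3 | h3 | h3
    · rw [← h3.1] at L8
      rw [hs.symm_other (a - 1) (by omega) (by omega)] at v7
      rcases hs.val_cases b with h1 | h1 | h1 <;> omega
    · omega
    · omega
  refine ⟨(mem_essSet_iff w).2 ⟨v1, v2, v3, v4, g1, g2, g3, g4⟩, ?_⟩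
  rintro ⟨rfl, rfl⟩
  rcases hs.val_cases b with h1 | h1 | h1
  · omega
  · omega
  · rcases hs.symm_cases (a - 1) with h4 | h4 | h4 <;> omega

theorem IsSwap.mem_essSet_of_mem_of_ne (hs : IsSwap w v i j)
    (hL : LeftPivot w p q i) (hR : RightPivot w p q j) {a b : ℕ}
    (hab : (a, b) ∈ EssSet w) (hne : ¬(a = p ∧ b = q)) : (a, b) ∈ EssSet v := by
  have hnr : ¬(pval w i < a ∧ a ≤ pval w j ∧ i ≤ b ∧ b < j) := fun h =>
    hne (eq_of_mem_essSet_of_mem_rect hL hR hab h.1 h.2.1 h.2.2.1 h.2.2.2)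
  have hij := hs.lt
  have hval := hs.val_lt
  obtain ⟨v1, v2, v3, v4, v5, v6, v7, v8⟩ := (mem_essSet_iff w).1 hab
  refine (mem_essSet_iff v).2 ⟨v1, v2, v3, v4, ?_, ?_, ?_, ?_⟩
  · rcases hs.val_cases b with h | h | h <;> omega
  · rcases hs.val_cases (b + 1) with h | h | h <;> omega
  · rcases hs.symm_cases (a - 1) with h | h | h <;> omega
  · rcases hs.symm_cases a with h | h | h <;> omega

theorem IsSwap.essSet_eq (hs : IsSwap w v i j)
    (hL : LeftPivot w p q i) (hR : RightPivot w p q j) : EssSet v = EssSet w \ {(p, q)} := by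
  ext ⟨a, b⟩
  simp only [Set.mem_sdiff, Set.mem_singleton_iff, Prod.mk.injEq]
  exact ⟨hs.mem_essSet_of_mem hL hR, fun h => hs.mem_essSet_of_mem_of_ne hL hR h.1 h.2⟩

theorem IsSwap.condA_iff (hs : IsSwap w v i j) {a b : ℕ}
    (hab : pval w i < a → a ≤ pval w j → i ≤ b → j ≤ b) : CondA v a b ↔ CondA w a b := by
  obtain ⟨h1, h2, h3, h4, h5, h6, h7, -, -, -⟩ := hs
  constructor
  all_goals
    rintro hA ⟨k, k1, k2, k3, k4⟩
    simp only [CondA, not_exists] at hA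
    have := h7 k
    have := hA i
    have := hA j
    have := hA k
    by_cases e1 : k = i
    · subst e1; omega
    · by_cases e2 : k = j
      · subst e2; omega
      · omega

theorem IsSwap.condB_iff (hs : IsSwap w v i j) {a b : ℕ}
    (hab : pval w i < a → a ≤ pval w j → i ≤ b → j ≤ b) : CondB v a b ↔ CondB w a b := by
  obtain ⟨h1, h2, h3, h4, h5, h6, h7, -, -, -⟩ := hs
  constructor
  all_goals
    rintro hB ⟨k, k1, k2, k3, k4⟩
    simp only [CondB, not_exists] at hB
    have := h7 k
    have := hB i
    have := hB j
    have := hB k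
    by_cases e1 : k = i
    · subst e1; omega
    · by_cases e2 : k = j
      · subst e2; omega
      · omega

theorem IsSwap.mem_essSet_iff (hs : IsSwap w v i j)
    (hL : LeftPivot w p q i) (hR : RightPivot w p q j) {a b : ℕ} :
    (a, b) ∈ EssSet v ↔ (a, b) ∈ EssSet w ∧ ¬(a = p ∧ b = q) := by
  rw [hs.essSet_eq hL hR]
  simp

theorem IsSwap.notMem_rect (hs : IsSwap w v i j)
    (hL : LeftPivot w p q i) (hR : RightPivot w p q j) {a b : ℕ} (hab : (a, b) ∈ EssSet v) :
    ¬(pval w i < a ∧ a ≤ pval w j ∧ i ≤ b ∧ b < j) := by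
  rintro ⟨h1, h2, h3, h4⟩
  have h := (hs.mem_essSet_iff hL hR).1 hab
  exact h.2 (eq_of_mem_essSet_of_mem_rect hL hR h.1 h1 h2 h3 h4)

theorem IsSwap.rk_eq_of_mem_essSet (hs : IsSwap w v i j)
    (hL : LeftPivot w p q i) (hR : RightPivot w p q j) {a b : ℕ} (hab : (a, b) ∈ EssSet v) :
    rk v a b = rk w a b := by
  have h := (_root_.mem_essSet_iff v).1 hab
  rw [hs.rk_eq a (by omega), if_neg (hs.notMem_rect hL hR hab), Nat.add_zero]

theorem IsSwap.condA_iff_of_mem_essSet (hs : IsSwap w v i j)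
    (hL : LeftPivot w p q i) (hR : RightPivot w p q j) {a b : ℕ} (hab : (a, b) ∈ EssSet v) :
    CondA v a b ↔ CondA w a b :=
  hs.condA_iff fun _ _ _ => by have := hs.notMem_rect hL hR hab; omega

theorem IsSwap.condB_iff_of_mem_essSet (hs : IsSwap w v i j)
    (hL : LeftPivot w p q i) (hR : RightPivot w p q j) {a b : ℕ} (hab : (a, b) ∈ EssSet v) :
    CondB v a b ↔ CondB w a b :=
  hs.condB_iff fun _ _ _ => by have := hs.notMem_rect hL hR hab; omega

theorem IsSwap.condW (hs : IsSwap w v i j) (hE : (p, q) ∈ EssSet'' w)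
    (hL : LeftPivot w p q i) (hR : RightPivot w p q j) {a b : ℕ} (hab : (a, b) ∈ EssSet v)
    (hB : ¬CondB w a b) (h : CondW w a b) : CondW v a b := by
  have hmem := fun {a b} => @IsSwap.mem_essSet_iff n w v p q i j hs hL hR a b
  obtain ⟨h1, h2⟩ := h
  refine ⟨fun p' hp' hm => h1 p' hp' (hmem.1 hm).1, ?_⟩
  rcases h2 with h2 | ⟨p', hp', h3, h4, h5⟩
  · left
    have hab' := (_root_.mem_essSet_iff w).1 (hmem.1 hab).1
    intro hD
    rw [mem_diagram_iff] at hD h2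
    have hc : ¬(b - 1 = j ∧ p ≤ a ∧ a < pval w j) := by
      rintro ⟨hb, ha, ha'⟩
      have hcB := hR.condB a ha ha'
      rw [← hb, Nat.sub_add_cancel (by omega)] at hcB
      exact hB (hcB (hmem.1 hab).1)
    have hr := hL.rows a
    have hval := hs.val_lt
    have hij := hs.lt
    rcases hs.val_cases (b - 1) with e1 | e1 | e1 <;> rcases hs.symm_cases a with e2 | e2 | e2 <;>
      omega
  · right
    have hne : ¬(p' = p ∧ b - 1 = q) := by
      rintro ⟨rfl, rfl⟩; exact hE.2.2 h4
    have hv := hmem.2 ⟨h3, hne⟩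
    refine ⟨p', hp', hv, (hs.condB_iff_of_mem_essSet hL hR hv).2 h4, ?_⟩
    rw [hs.rk_eq_of_mem_essSet hL hR hv, hs.rk_eq_of_mem_essSet hL hR hab, h5]

theorem IsSwap.condY (hs : IsSwap w v i j) (hE : (p, q) ∈ EssSet'' w)
    (hL : LeftPivot w p q i) (hR : RightPivot w p q j) {a b : ℕ} (hab : (a, b) ∈ EssSet v)
    (hB : ¬CondB w a b) (h : CondY w a b) : CondY v a b := by
  have hmem := fun {a b} => @IsSwap.mem_essSet_iff n w v p q i j hs hL hR a b
  obtain ⟨h1, h2⟩ := h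
  refine ⟨fun q' hq' hm => h1 q' hq' (hmem.1 hm).1, ?_⟩
  rcases h2 with h2 | ⟨q', hq', h3, h4, h5⟩
  · left
    have hab' := (_root_.mem_essSet_iff w).1 (hmem.1 hab).1
    intro hD
    rw [mem_diagram_iff] at hD h2
    have hc : ¬(a + 1 = pval w i ∧ i < b ∧ b ≤ q) := by
      rintro ⟨ha, hb, hb'⟩
      have hcB := hL.condB b hb hb'
      rw [← ha, Nat.add_sub_cancel] at hcB
      exact hB (hcB (hmem.1 hab).1)
    have hr := hR.cols b
    have hval := hs.val_lt
    have hij := hs.lt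
    rcases hs.val_cases b with e1 | e1 | e1 <;>
      rcases hs.symm_cases (a + 1) with e2 | e2 | e2 <;> omega
  · right
    have hne : ¬(a + 1 = p ∧ q' = q) := by
      rintro ⟨rfl, rfl⟩; exact hE.2.2 h4
    have hv := hmem.2 ⟨h3, hne⟩
    refine ⟨q', hq', hv, (hs.condB_iff_of_mem_essSet hL hR hv).2 h4, ?_⟩
    rw [hs.rk_eq_of_mem_essSet hL hR hv, hs.rk_eq_of_mem_essSet hL hR hab, h5]

theorem IsSwap.condX (hs : IsSwap w v i j) (hE : (p, q) ∈ EssSet'' w)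
    (hL : LeftPivot w p q i) (hR : RightPivot w p q j) {a b : ℕ} (hab : (a, b) ∈ EssSet v)
    (h : CondX w a b) : CondX v a b := by
  have hmem := fun {a b} => @IsSwap.mem_essSet_iff n w v p q i j hs hL hR a b
  have habw := (hmem.1 hab).1
  obtain ⟨p', hp', h1, huniq, hB, h2, h3⟩ := (condX_iff habw).1 h
  have hne : ¬(p' = p ∧ b = q) := by
    rintro ⟨rfl, rfl⟩; exact hE.2.2 hB
  have hv := hmem.2 ⟨h1, hne⟩
  rw [condX_iff hab]
  refine ⟨p', hp', hv, fun p'' hp'' hm => huniq p'' hp'' (hmem.1 hm).1,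
    (hs.condB_iff_of_mem_essSet hL hR hv).2 hB, ?_, fun k hk hkb => ?_⟩
  · rw [hs.rk_eq_of_mem_essSet hL hR hv, hs.rk_eq_of_mem_essSet hL hR hab, h2]
  · have n1 := hs.notMem_rect hL hR hab
    have n2 := hs.notMem_rect hL hR hv
    have hab' := (_root_.mem_essSet_iff w).1 habw
    have hone := fun hp hq hA hA' hB hB' =>
      eq_of_rk_le_succ w (p := a) (p' := p') (q := b) (q' := b) (k := i) (l := j) hp hq h2.le
        hA hA' hB hB'
    have hi := hs.one_le
    have hij := hs.lt
    have hLk := hL.cols k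
    have hRb := hR.below
    have hLl := hL.val_lt
    have hRv := hR.le_val
    have k4 : a - 1 = pval w j → pval w.symm (pval w j + 1) = pval w.symm a := by
      intro h; rw [← h, Nat.sub_add_cancel (by omega)]
    have := h3 k
    have := h3 j
    rcases hs.val_cases k with e1 | e1 | e1 <;>
      rcases hs.symm_cases (a - 1) with e2 | e2 | e2 <;> omega

theorem IsSwap.condZ (hs : IsSwap w v i j) (hE : (p, q) ∈ EssSet'' w)
    (hL : LeftPivot w p q i) (hR : RightPivot w p q j) {a b : ℕ} (hab : (a, b) ∈ EssSet v)
    (h : CondZ w a b) : CondZ v a b := by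
  have hmem := fun {a b} => @IsSwap.mem_essSet_iff n w v p q i j hs hL hR a b
  have habw := (hmem.1 hab).1
  obtain ⟨q', hq', h1, huniq, hB, h2, h3⟩ := (condZ_iff habw).1 h
  have hne : ¬(a = p ∧ q' = q) := by
    rintro ⟨rfl, rfl⟩; exact hE.2.2 hB
  have hv := hmem.2 ⟨h1, hne⟩
  rw [condZ_iff hab]
  refine ⟨q', hq', hv, fun q'' hq'' hm => huniq q'' hq'' (hmem.1 hm).1,
    (hs.condB_iff_of_mem_essSet hL hR hv).2 hB, ?_, fun r hr hrb => ?_⟩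
  · rw [hs.rk_eq_of_mem_essSet hL hR hv, hs.rk_eq_of_mem_essSet hL hR hab, h2]
  · have n1 := hs.notMem_rect hL hR hab
    have n2 := hs.notMem_rect hL hR hv
    have hab' := (_root_.mem_essSet_iff w).1 habw
    have hone := fun hp hq hA hA' hB hB' =>
      eq_of_rk_le_succ w (p := a) (p' := a) (q := b) (q' := q') (k := i) (l := j) hp hq h2.le
        hA hA' hB hB'
    have hi := hs.one_le
    have hij := hs.lt
    have hj := hs.le
    have hRr := hR.rows r
    have hLa := hL.left
    have hLv := hL.val_lt
    have hRv := hR.le_val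
    have k4 : b + 1 = i → pval w (i - 1) = pval w b := by rintro rfl; rfl
    have hsym := pval_symm_pval w hi (hij.le.trans hj)
    have := h3 r
    have := h3 (pval w i)
    rcases hs.val_cases (b + 1) with e1 | e1 | e1 <;>
      rcases hs.symm_cases r with e2 | e2 | e2 <;> omega

end Removal

section Induction

variable {n : ℕ}

/-- One box of `E''` can be removed while staying almost defined by inclusions. -/
theorem AlmostDBI.exists_remove {w : Equiv.Perm (Fin n)} (hw : AlmostDBI w) {p q : ℕ}
    (hE : (p, q) ∈ EssSet'' w) : ∃ v : Equiv.Perm (Fin n), AlmostDBI v ∧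
      EssSet v = EssSet w \ {(p, q)} ∧ (∀ pq ∈ EssSet v, rk v pq.1 pq.2 = rk w pq.1 pq.2) ∧
      EssSet'' v = EssSet'' w \ {(p, q)} ∧ ell v = ell w + 1 := by
  have hWXYZ := (hw p q hE.1).resolve_left (not_or.2 hE.2)
  obtain ⟨i, hL⟩ : ∃ i, LeftPivot w p q i :=
    hWXYZ.1.elim (fun h => ⟨_, h.leftPivot hE.1⟩) fun h => ⟨_, h.leftPivot hE.1⟩
  obtain ⟨j, hR⟩ : ∃ j, RightPivot w p q j :=
    hWXYZ.2.elim (fun h => ⟨_, h.rightPivot hE.1⟩) fun h => ⟨_, h.rightPivot hE.1⟩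
  obtain ⟨v, hs⟩ := exists_isSwap w hL.one_le (hL.le.trans_lt hR.lt) hR.le
    (hL.val_lt.trans_le hR.le_val)
  have hEv := hs.essSet_eq hL hR
  refine ⟨v, ?_, hEv, fun _ => hs.rk_eq_of_mem_essSet hL hR, ?_, hs.ell_eq fun k hik hkj => ?_⟩
  · intro a b hab
    rw [hs.condA_iff_of_mem_essSet hL hR hab, hs.condB_iff_of_mem_essSet hL hR hab]
    by_cases hB : CondB w a b
    · exact Or.inl (Or.inr hB)
    · have habw : (a, b) ∈ EssSet w := (hEv ▸ hab).1
      exact (hw a b habw).imp_right fun h =>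
        ⟨h.1.imp (hs.condW hE hL hR hab hB) (hs.condX hE hL hR hab),
          h.2.imp (hs.condY hE hL hR hab hB) (hs.condZ hE hL hR hab)⟩
  · ext ⟨a, b⟩
    by_cases hab : (a, b) ∈ EssSet v
    · have := hEv ▸ hab
      simp only [EssSet'', Set.mem_ofPred_eq, Set.mem_sdiff, hab, this.1, this.2,
        hs.condA_iff_of_mem_essSet hL hR hab, hs.condB_iff_of_mem_essSet hL hR hab,
        not_false_eq_true, and_true]
    · exact iff_of_false (fun h => hab h.1) fun h => hab (hEv ▸ ⟨h.1.1, h.2⟩)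
  · have := hL.cols k hik
    have := hR.cols k
    omega

theorem AlmostDBI.exists_dbi {m : ℕ} {w : Equiv.Perm (Fin n)} (hw : AlmostDBI w)
    (hm : (EssSet'' w).ncard = m) : ∃ v : Equiv.Perm (Fin n),
      EssSet v = EssSet w \ EssSet'' w ∧ (∀ pq ∈ EssSet v, rk v pq.1 pq.2 = rk w pq.1 pq.2) ∧
      DefinedByInclusions v ∧ ell v = ell w + m := by
  have hfin : (EssSet'' w).Finite := (essSet_finite w).subset fun _ h => h.1
  induction m generalizing w with
  | zero =>
    rw [Set.ncard_eq_zero hfin] at hm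
    refine ⟨w, by simp [hm], fun _ _ => rfl, fun p q hE => ?_, rfl⟩
    by_contra hAB
    have : (p, q) ∈ EssSet'' w := ⟨hE, not_or.1 hAB⟩
    simp [hm] at this
  | succ m ih =>
    obtain ⟨⟨p, q⟩, hpq⟩ := (Set.ncard_pos hfin).1 (by omega : 0 < (EssSet'' w).ncard)
    obtain ⟨u, hu, huE, hurk, huE', hul⟩ := hw.exists_remove hpq
    obtain ⟨v, hvE, hvrk, hv, hvl⟩ := ih hu
      (by rw [huE', Set.ncard_sdiff_singleton_of_mem hpq, hm, Nat.add_sub_cancel])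
      (huE' ▸ hfin.subset Set.sdiff_subset)
    refine ⟨v, ?_, fun pq h => ?_, hv, by omega⟩
    · rw [hvE, huE, huE', Set.sdiff_sdiff, Set.singleton_union, Set.insert_sdiff_singleton,
        Set.insert_eq_of_mem hpq]
    · rw [hvrk pq h, hurk pq (hvE ▸ h).1]

end Induction

/-- If `w` is almost defined by inclusions, then there is a unique permutation `v` with
`E(v) = E(w) ∖ E″(w)` and `r_v = r_w` on `E(v)`; moreover this `v` is defined by
inclusions and `ℓ(v) = ℓ(w) + #E″(w)`. -/
theorem exists_unique_dbi_of_almostDBI {n : ℕ} (w : Equiv.Perm (Fin n))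
    (hw : AlmostDBI w) :
    (∃! v : Equiv.Perm (Fin n),
        EssSet v = EssSet w \ EssSet'' w ∧
          ∀ pq ∈ EssSet v, rk v pq.1 pq.2 = rk w pq.1 pq.2) ∧
      ∀ v : Equiv.Perm (Fin n),
        (EssSet v = EssSet w \ EssSet'' w ∧
            ∀ pq ∈ EssSet v, rk v pq.1 pq.2 = rk w pq.1 pq.2) →
          DefinedByInclusions v ∧ ell v = ell w + (EssSet'' w).ncard := by
  obtain ⟨u, huE, hurk, hu, hul⟩ := hw.exists_dbi rfl
  have huniq : ∀ v : Equiv.Perm (Fin n), (EssSet v = EssSet w \ EssSet'' w ∧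
      ∀ pq ∈ EssSet v, rk v pq.1 pq.2 = rk w pq.1 pq.2) → v = u := fun v hv =>
    eq_of_essSet_eq (hv.1.trans huE.symm) fun pq h =>
      (hv.2 pq ((hv.1.trans huE.symm) ▸ h)).trans (hurk pq h).symm
  exact ⟨⟨u, ⟨huE, hurk⟩, huniq⟩, fun v hv => huniq v hv ▸ ⟨hu, hul⟩⟩
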